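/- arXiv:2605.21167 — 2 statements merged into one kernel-verified Lean document; each statement's English description precedes it below -/
import Mathlib

section
/- For independent x, x' ~ N(0, σ²I_d), c > 0, and p ∈ ℕ, the expected squared normalized polynomial kernel satisfies E[((c + xᵀx')²/((c+‖x‖²)(c+‖x'‖²)))^p] = Σ_{k=0}^{p} C(2p, 2k)·(c/σ²)^{2p−2k}·(E[(χ²_d)^k / (c/σ² + χ²_d)^p])²·Π_{i=0}^{k−1}(1+2i)/(d+2i), where χ²_d denotes a chi-squared random variable with d degrees of freedom. -/
open MeasureTheory ProbabilityTheory Finset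

theorem integrable_eval_gaussianReal (P : Polynomial ℝ) (v : NNReal) :
    Integrable (fun x => P.eval x) (gaussianReal 0 v) := by
  simp_rw [Polynomial.eval_eq_sum_range]
  refine integrable_finsetSum _ fun i _ => Integrable.const_mul ?_ _
  have h := (memLp_id_gaussianReal (μ := 0) (v := v) i).integrable_norm_pow'
  exact h.mono (by fun_prop) (by simp)

/-- Gaussian integration by parts for polynomials. -/
theorem integral_id_mul_eval_gaussianReal (P : Polynomial ℝ) :
    ∫ x, x * P.eval x ∂gaussianReal 0 1 = ∫ x, P.derivative.eval x ∂gaussianReal 0 1 := by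
  have hint (Q : Polynomial ℝ) :
      Integrable (fun x => Q.eval x * gaussianPDFReal 0 1 x) := by
    have h := integrable_eval_gaussianReal Q 1
    rw [gaussianReal_of_var_ne_zero _ one_ne_zero,
      integrable_withDensity_iff_integrable_smul' (measurable_gaussianPDF 0 1)
        (by simp [gaussianPDF])] at h
    simpa [toReal_gaussianPDF, mul_comm] using h
  have hd (x : ℝ) : HasDerivAt (gaussianPDFReal 0 1) (-(x * gaussianPDFReal 0 1 x)) x := by
    rw [gaussianPDFReal_def]
    have : HasDerivAt (fun x : ℝ => -(x - 0) ^ 2 / (2 * ((1 : NNReal) : ℝ))) (-x) x := by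
      have := (((hasDerivAt_id x).sub_const 0).pow 2).neg.div_const (2 * ((1 : NNReal) : ℝ))
      convert! this using 1
      simp
      ring
    convert! (this.exp.const_mul (√(2 * Real.pi * ((1 : NNReal) : ℝ)))⁻¹) using 1
    ring
  have key := integral_mul_deriv_eq_deriv_mul_of_integrable
    (fun x _ => P.hasDerivAt x) (fun x _ => hd x)
    ((hint (Polynomial.X * P)).neg.congr (.of_forall fun x => by simp; ring)) (hint _) (hint P)
  simp only [integral_gaussianReal_eq_integral_smul one_ne_zero, smul_eq_mul]
  rw [← neg_inj, ← integral_neg]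
  calc _ = ∫ x, P.eval x * -(x * gaussianPDFReal 0 1 x) := by congr with x; ring
    _ = _ := key
    _ = _ := by simp_rw [mul_comm]

/-- The standard Gaussian measure on `Fin d → ℝ`. -/
noncomputable abbrev stdGaussianPi (d : ℕ) : Measure (Fin d → ℝ) :=
  Measure.pi fun _ => gaussianReal 0 1

theorem integral_even_pow_gaussianReal (k : ℕ) :
    ∫ x, x ^ (2 * k) ∂gaussianReal 0 1 = ∏ i ∈ range k, (1 + 2 * (i : ℝ)) := by
  induction k with
  | zero => simp
  | succ k ih =>
    have h := integral_id_mul_eval_gaussianReal (Polynomial.X ^ (2 * k + 1))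
    simp only [Polynomial.eval_pow, Polynomial.eval_X, Polynomial.derivative_X_pow,
      Polynomial.eval_mul, Polynomial.eval_C, integral_const_mul, add_tsub_cancel_right, ih] at h
    rw [prod_range_succ, mul_comm (∏ i ∈ range k, _), add_comm (1 : ℝ) (2 * k)]
    push_cast at h
    rw [← h]
    congr with x
    ring

theorem integrable_sum_sq_pow (d k : ℕ) :
    Integrable (fun z => (∑ i, z i ^ 2) ^ k) (stdGaussianPi d) := by
  have h := (IsGaussian.memLp_id (stdGaussian (EuclideanSpace ℝ (Fin d)))
    ((2 * k : ℕ) : ENNReal) (ENNReal.natCast_ne_top _)).integrable_norm_pow'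
  rw [← map_pi_eq_stdGaussian, integrable_map_measure (by fun_prop) (by fun_prop)] at h
  refine h.congr (.of_forall fun z => ?_)
  simp [pow_mul, EuclideanSpace.norm_sq_eq]

theorem integrable_sq_mul_sum_sq_pow {d : ℕ} (i : Fin d) (k : ℕ) :
    Integrable (fun z => z i ^ 2 * (∑ j, z j ^ 2) ^ k) (stdGaussianPi d) := by
  refine (integrable_sum_sq_pow d (k + 1)).mono' (by fun_prop) (.of_forall fun z => ?_)
  rw [Real.norm_of_nonneg (by positivity), pow_succ' (∑ j, z j ^ 2) k]
  exact mul_le_mul_of_nonneg_right (single_le_sum (f := fun j => z j ^ 2)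
    (fun j _ => sq_nonneg _) (mem_univ i)) (by positivity)

/-- Gaussian integration by parts in one coordinate for powers of the squared norm. -/
theorem integral_sq_mul_sum_sq_pow (n k : ℕ) (i : Fin (n + 1)) :
    ∫ z, z i ^ 2 * (∑ j, z j ^ 2) ^ k ∂stdGaussianPi (n + 1) =
      ∫ z, (∑ j, z j ^ 2) ^ k ∂stdGaussianPi (n + 1) +
        2 * k * ∫ z, z i ^ 2 * (∑ j, z j ^ 2) ^ (k - 1) ∂stdGaussianPi (n + 1) := by
  have hint (m : ℕ) := integrable_sq_mul_sum_sq_pow i m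
  have hmp := measurePreserving_piFinSuccAbove (fun _ : Fin (n + 1) => gaussianReal 0 1) i
  have hsum (z : Fin (n + 1) → ℝ) : ∑ j, z j ^ 2 = z i ^ 2 + ∑ j, z (i.succAbove j) ^ 2 :=
    Fin.sum_univ_succAbove _ i
  have fub (f : ℝ × (Fin n → ℝ) → ℝ) (hf : Measurable f)
      (h : Integrable (fun z : Fin (n + 1) → ℝ => f (z i, fun j => z (i.succAbove j)))
        (stdGaussianPi (n + 1))) :
      ∫ z, f (z i, fun j => z (i.succAbove j)) ∂stdGaussianPi (n + 1) =
        ∫ w, ∫ t, f (t, w) ∂gaussianReal 0 1 ∂stdGaussianPi n := by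
    rw [← integral_prod_symm f ((hmp.integrable_comp hf.aestronglyMeasurable).1 h)]
    exact hmp.integral_comp' f
  rw [← integral_const_mul, ← integral_add (integrable_sum_sq_pow _ _) ((hint _).const_mul _)]
  simp only [hsum] at hint ⊢
  have hS := integrable_sum_sq_pow (n + 1) k
  simp only [hsum] at hS
  refine (fub (fun p => p.1 ^ 2 * (p.1 ^ 2 + ∑ j, p.2 j ^ 2) ^ k) (by fun_prop)
    (hint k)).trans (Eq.trans ?_ (fub (fun p => (p.1 ^ 2 + ∑ j, p.2 j ^ 2) ^ k +
      2 * k * (p.1 ^ 2 * (p.1 ^ 2 + ∑ j, p.2 j ^ 2) ^ (k - 1))) (by fun_prop)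
    (hS.add ((hint _).const_mul _))).symm)
  congr with w
  dsimp only
  generalize ∑ j, w j ^ 2 = b
  have h := integral_id_mul_eval_gaussianReal
    (Polynomial.X * (Polynomial.X ^ 2 + Polynomial.C b) ^ k)
  simp [Polynomial.derivative_pow] at h
  convert h using 3 with t t
  · ring
  · ring

theorem integral_sum_sq_pow (d k : ℕ) (hd : d ≠ 0) :
    ∫ z, (∑ i, z i ^ 2) ^ k ∂stdGaussianPi d = ∏ i ∈ range k, ((d : ℝ) + 2 * i) := by
  obtain ⟨n, rfl⟩ := Nat.exists_eq_succ_of_ne_zero hd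
  have hsum (m : ℕ) : ∫ z, (∑ j, z j ^ 2) ^ (m + 1) ∂stdGaussianPi (n + 1) =
      ∑ i, ∫ z, z i ^ 2 * (∑ j, z j ^ 2) ^ m ∂stdGaussianPi (n + 1) := by
    rw [← integral_finsetSum _ fun i _ => integrable_sq_mul_sum_sq_pow i m]
    simp_rw [pow_succ', sum_mul]
  induction k with
  | zero => simp
  | succ k ih =>
    have hk : (k : ℝ) * ∑ i, ∫ z, z i ^ 2 * (∑ j, z j ^ 2) ^ (k - 1) ∂stdGaussianPi (n + 1) =
        k * ∫ z, (∑ j, z j ^ 2) ^ k ∂stdGaussianPi (n + 1) := by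
      cases k with
      | zero => simp
      | succ k => rw [hsum]; rfl
    rw [prod_range_succ, ← ih, hsum]
    simp only [integral_sq_mul_sum_sq_pow n k, sum_add_distrib, ← mul_sum, mul_assoc]
    rw [hk]
    simp
    ring

theorem norm_sq_toLp {d : ℕ} (x : Fin d → ℝ) : ‖WithLp.toLp 2 x‖ ^ 2 = ∑ i, x i ^ 2 := by
  simp [EuclideanSpace.norm_sq_eq]

/-- By rotation invariance, the Gaussian integral of a power of `⟪x, z⟫` against a function of `‖z‖`
depends on `x` only through `‖x‖`. -/
theorem integral_inner_pow_mul_stdGaussian {E : Type*} [NormedAddCommGroup E]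
    [InnerProductSpace ℝ E] [FiniteDimensional ℝ E] [MeasurableSpace E] [BorelSpace E]
    (g : ℝ → ℝ) (m : ℕ) (x e : E) (he : ‖e‖ = 1) :
    ∫ z, inner ℝ x z ^ m * g ‖z‖ ∂stdGaussian E =
      ‖x‖ ^ m * ∫ z, inner ℝ e z ^ m * g ‖z‖ ∂stdGaussian E := by
  obtain ⟨f, hf⟩ : ∃ f : E ≃ₗᵢ[ℝ] E, f x = ‖x‖ • e :=
    ⟨_, Submodule.reflection_sub (by simp [norm_smul, he])⟩
  have hmp : MeasurePreserving f (stdGaussian E) (stdGaussian E) :=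
    ⟨f.continuous.measurable, stdGaussian_map f⟩
  rw [← integral_const_mul, ← hmp.integral_comp f.toHomeomorph.measurableEmbedding
    (fun z => ‖x‖ ^ m * (inner ℝ e z ^ m * g ‖z‖))]
  congr with z
  rw [← mul_assoc, ← mul_pow, ← real_inner_smul_left, ← hf, f.inner_map_map, f.norm_map]

theorem integral_dot_pow_mul_stdGaussianPi {d : ℕ} (g : ℝ → ℝ) (m : ℕ) (x e : Fin d → ℝ)
    (he : ∑ i, e i ^ 2 = 1) :
    ∫ z, (∑ i, x i * z i) ^ (2 * m) * g (∑ i, z i ^ 2) ∂stdGaussianPi d =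
      (∑ i, x i ^ 2) ^ m *
        ∫ z, (∑ i, e i * z i) ^ (2 * m) * g (∑ i, z i ^ 2) ∂stdGaussianPi d := by
  have hmp : MeasurePreserving (MeasurableEquiv.toLp 2 (Fin d → ℝ)) (stdGaussianPi d)
      (stdGaussian (EuclideanSpace ℝ (Fin d))) :=
    ⟨MeasurableEquiv.measurable _, map_pi_eq_stdGaussian⟩
  have h := integral_inner_pow_mul_stdGaussian (fun r => g (r ^ 2)) (2 * m) (WithLp.toLp 2 x)
    (WithLp.toLp 2 e) (by rw [← sq_eq_sq₀ (norm_nonneg _) zero_le_one, norm_sq_toLp, he, one_pow])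
  rw [← hmp.integral_comp', ← hmp.integral_comp', pow_mul, norm_sq_toLp] at h
  simpa [norm_sq_toLp, PiLp.inner_apply, mul_comm] using h

theorem integral_odd_eq_zero {d : ℕ} (f : (Fin d → ℝ) → ℝ) (hf : ∀ z, f (-z) = -f z) :
    ∫ z, f z ∂stdGaussianPi d = 0 := by
  have hmp : MeasurePreserving (MeasurableEquiv.neg (Fin d → ℝ)) (stdGaussianPi d)
      (stdGaussianPi d) :=
    measurePreserving_pi _ _ fun _ => ⟨measurable_neg,
      (gaussianReal_map_neg (μ := 0) (v := 1)).trans (by rw [neg_zero])⟩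
  have h := hmp.integral_comp' f
  simp only [MeasurableEquiv.neg_apply, hf, integral_neg] at h
  linarith

theorem abs_dot_pow_le {d : ℕ} (x z : Fin d → ℝ) (m : ℕ) :
    |(∑ i, x i * z i) ^ (2 * m)| ≤ (∑ i, x i ^ 2) ^ m * (∑ i, z i ^ 2) ^ m := by
  rw [pow_mul, abs_of_nonneg (by positivity), ← mul_pow]
  gcongr
  exact sum_mul_sq_le_sq_mul_sq _ _ _

/-- The even moments of `x ⬝ z` weighted by a bounded function of `‖z‖²`. -/
theorem integral_dot_pow_mul {d : ℕ} (hd : d ≠ 0) (g : ℝ → ℝ) (hg : Measurable g) {B : ℝ}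
    (hB : ∀ r, |g r| ≤ B) (m : ℕ) (x : Fin d → ℝ) :
    ∫ z, (∑ i, x i * z i) ^ (2 * m) * g (∑ i, z i ^ 2) ∂stdGaussianPi d =
      (∑ i, x i ^ 2) ^ m * ((∏ i ∈ range m, (1 + 2 * (i : ℝ)) / ((d : ℝ) + 2 * i)) *
        ∫ z, (∑ i, z i ^ 2) ^ m * g (∑ i, z i ^ 2) ∂stdGaussianPi d) := by
  obtain ⟨n, rfl⟩ := Nat.exists_eq_succ_of_ne_zero hd
  set e : Fin (n + 1) → ℝ := Pi.single 0 1
  have he : ∑ i, e i ^ 2 = 1 := by simp [e, Pi.single_apply]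
  have hmom : ∫ z, (∑ i, e i * z i) ^ (2 * m) ∂stdGaussianPi (n + 1) =
      ∏ i ∈ range m, (1 + 2 * (i : ℝ)) := by
    simp only [e, Pi.single_apply, ite_mul, one_mul, zero_mul, sum_ite_eq', mem_univ, if_true]
    rw [← integral_even_pow_gaussianReal]
    have h := measurePreserving_eval (fun _ : Fin (n + 1) => gaussianReal 0 1) 0
    rw [← h.map_eq, integral_map h.measurable.aemeasurable (by fun_prop)]
  have hone (y : Fin (n + 1) → ℝ) : ∫ z, (∑ i, z i * y i) ^ (2 * m) ∂stdGaussianPi (n + 1) =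
      (∑ i, y i ^ 2) ^ m * ∏ i ∈ range m, (1 + 2 * (i : ℝ)) := by
    have h := integral_dot_pow_mul_stdGaussianPi (fun _ => 1) m y e he
    simp only [mul_one] at h
    rw [← hmom, ← h]
    simp_rw [mul_comm]
  have hgi (k : ℕ) : Integrable (fun z => (∑ i, z i ^ 2) ^ k * g (∑ i, z i ^ 2))
      (stdGaussianPi (n + 1)) :=
    (integrable_sum_sq_pow _ k).mul_bdd (c := B)
      (hg.comp (by fun_prop)).aestronglyMeasurable (.of_forall fun z => hB _)
  have hint : Integrable (Function.uncurry fun x z : Fin (n + 1) → ℝ =>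
      (∑ i, x i * z i) ^ (2 * m) * g (∑ i, z i ^ 2))
      ((stdGaussianPi (n + 1)).prod (stdGaussianPi (n + 1))) := by
    refine ((integrable_sum_sq_pow _ m).mul_prod (hgi m)).mono ?_ (.of_forall fun p => ?_)
    · exact Measurable.aestronglyMeasurable (by unfold Function.uncurry; fun_prop)
    · simp only [Function.uncurry, norm_mul, Real.norm_eq_abs, ← mul_assoc]
      refine mul_le_mul_of_nonneg_right ((abs_dot_pow_le _ _ m).trans ?_) (abs_nonneg _)
      rw [← abs_mul]
      exact le_abs_self _
  have hswap := integral_integral_swap hint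
  rw [integral_congr_ae (.of_forall fun x => integral_dot_pow_mul_stdGaussianPi g m x e he)] at hswap
  simp only [integral_mul_const, hone] at hswap
  rw [integral_sum_sq_pow _ _ hd] at hswap
  rw [integral_dot_pow_mul_stdGaussianPi g m x e he, prod_div_distrib]
  have hpos : 0 < ∏ i ∈ range m, (((n + 1 : ℕ) : ℝ) + 2 * i) :=
    prod_pos fun i _ => by positivity
  congr 1
  rw [div_mul_eq_mul_div, eq_div_iff hpos.ne', mul_comm, hswap, ← integral_const_mul]
  congr with z
  ring

theorem sum_range_two_mul_add_one (f : ℕ → ℝ) (p : ℕ) :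
    ∑ j ∈ range (2 * p + 1), f j =
      ∑ k ∈ range (p + 1), f (2 * k) + ∑ k ∈ range p, f (2 * k + 1) := by
  induction p with
  | zero => simp
  | succ p ih =>
    rw [show 2 * (p + 1) + 1 = 2 * p + 1 + 1 + 1 by ring, sum_range_succ, sum_range_succ, ih,
      sum_range_succ (fun k => f (2 * k)) (p + 1), sum_range_succ (fun k => f (2 * k + 1)) p]
    ring_nf

theorem measurePreserving_const_mul_pi_gaussianReal (d : ℕ) {σ : ℝ} {v : NNReal}
    (hv : (v : ℝ) = σ ^ 2) :
    MeasurePreserving (fun (z : Fin d → ℝ) i => σ * z i) (stdGaussianPi d)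
      (Measure.pi fun _ : Fin d => gaussianReal 0 v) :=
  measurePreserving_pi _ _ fun _ => ⟨measurable_const_mul σ,
    (gaussianReal_map_const_mul σ).trans (by
      rw [mul_zero, mul_one]
      congr 1
      exact NNReal.eq hv.symm)⟩

/-- Mixed moments of the inner product of two independent standard Gaussian vectors, weighted by a
bounded function of each squared norm. -/
theorem integral_dot_pow_mul_mul {d : ℕ} (hd : d ≠ 0) (g : ℝ → ℝ) (hg : Measurable g) {B : ℝ}
    (hB : ∀ r, |g r| ≤ B) (m : ℕ)
    (hint : Integrable (fun w : (Fin d → ℝ) × (Fin d → ℝ) =>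
      (∑ i, w.1 i * w.2 i) ^ (2 * m) * (g (∑ i, w.1 i ^ 2) * g (∑ i, w.2 i ^ 2)))
      ((stdGaussianPi d).prod (stdGaussianPi d))) :
    ∫ w, (∑ i, w.1 i * w.2 i) ^ (2 * m) * (g (∑ i, w.1 i ^ 2) * g (∑ i, w.2 i ^ 2))
      ∂(stdGaussianPi d).prod (stdGaussianPi d) =
      (∫ z, (∑ i, z i ^ 2) ^ m * g (∑ i, z i ^ 2) ∂stdGaussianPi d) ^ 2 *
        ∏ i ∈ range m, (1 + 2 * (i : ℝ)) / ((d : ℝ) + 2 * i) := by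
  rw [integral_prod _ hint, sq, mul_assoc, ← integral_mul_const]
  congr with x
  calc _ = g (∑ i, x i ^ 2) *
        ∫ z, (∑ i, x i * z i) ^ (2 * m) * g (∑ i, z i ^ 2) ∂stdGaussianPi d := by
        rw [← integral_const_mul]
        congr with z
        ring
    _ = _ := by
        rw [integral_dot_pow_mul hd g hg hB]
        ring

theorem integral_dot_odd_pow_mul_mul {d : ℕ} (g : ℝ → ℝ) (m : ℕ)
    (hint : Integrable (fun w : (Fin d → ℝ) × (Fin d → ℝ) =>
      (∑ i, w.1 i * w.2 i) ^ (2 * m + 1) * (g (∑ i, w.1 i ^ 2) * g (∑ i, w.2 i ^ 2)))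
      ((stdGaussianPi d).prod (stdGaussianPi d))) :
    ∫ w, (∑ i, w.1 i * w.2 i) ^ (2 * m + 1) * (g (∑ i, w.1 i ^ 2) * g (∑ i, w.2 i ^ 2))
      ∂(stdGaussianPi d).prod (stdGaussianPi d) = 0 := by
  rw [integral_prod _ hint]
  refine (integral_congr_ae (.of_forall fun x => integral_odd_eq_zero _ fun z => ?_)).trans
    (integral_zero _ _)
  simp [(odd_two_mul_add_one m).neg_pow]

theorem integrable_dot_pow_mul_mul {d : ℕ} (g : ℝ → ℝ) (hg : Measurable g) {B : ℝ}
    (hB : ∀ r, |g r| ≤ B) (j : ℕ) :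
    Integrable (fun w : (Fin d → ℝ) × (Fin d → ℝ) =>
      (∑ i, w.1 i * w.2 i) ^ j * (g (∑ i, w.1 i ^ 2) * g (∑ i, w.2 i ^ 2)))
      ((stdGaussianPi d).prod (stdGaussianPi d)) := by
  have hB0 : 0 ≤ B := (abs_nonneg _).trans (hB 0)
  have hint : Integrable (fun w : (Fin d → ℝ) × (Fin d → ℝ) => (∑ i, w.1 i * w.2 i) ^ j)
      ((stdGaussianPi d).prod (stdGaussianPi d)) := by
    refine (((integrable_sum_sq_pow d j).mul_prod (integrable_sum_sq_pow d j)).add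
      (integrable_const 1)).mono' (by fun_prop) (.of_forall fun w => ?_)
    have h := abs_dot_pow_le w.1 w.2 j
    rw [mul_comm, pow_mul, abs_of_nonneg (by positivity), ← sq_abs] at h
    simp only [Pi.add_apply, Real.norm_eq_abs]
    nlinarith [sq_nonneg (|(∑ i, w.1 i * w.2 i) ^ j| - 1), abs_nonneg ((∑ i, w.1 i * w.2 i) ^ j)]
  refine hint.mul_bdd (c := B * B) (Measurable.aestronglyMeasurable
    ((hg.comp (by fun_prop)).mul (hg.comp (by fun_prop)))) (.of_forall fun w => ?_)
  rw [norm_mul]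
  exact mul_le_mul (hB _) (hB _) (norm_nonneg _) hB0

/-- Expansion of the expected squared normalized polynomial kernel for
independent x, x' ~ N(0, σ²I_d). -/
theorem expected_sq_normalized_polynomial_kernel
    (d : ℕ) (hd : 2 ≤ d) (σ c : ℝ) (hσ : 0 < σ) (hc : 0 < c) (p : ℕ) :
    (∫ xx : (Fin d → ℝ) × (Fin d → ℝ),
        ((c + ∑ i, xx.1 i * xx.2 i) ^ 2 /
          ((c + ∑ i, (xx.1 i) ^ 2) * (c + ∑ i, (xx.2 i) ^ 2))) ^ p
      ∂((Measure.pi fun _ : Fin d => gaussianReal 0 ⟨σ ^ 2, sq_nonneg σ⟩).prod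
          (Measure.pi fun _ : Fin d => gaussianReal 0 ⟨σ ^ 2, sq_nonneg σ⟩)))
    = ∑ k ∈ Finset.range (p + 1),
        ((2 * p).choose (2 * k) : ℝ) * (c / σ ^ 2) ^ (2 * p - 2 * k) *
        (∫ z : Fin d → ℝ,
            (∑ i, (z i) ^ 2) ^ k / (c / σ ^ 2 + ∑ i, (z i) ^ 2) ^ p
          ∂(Measure.pi fun _ : Fin d => gaussianReal 0 1)) ^ 2 *
        ∏ i ∈ Finset.range k, (1 + 2 * (i : ℝ)) / ((d : ℝ) + 2 * i) := by
  have hmp := (measurePreserving_const_mul_pi_gaussianReal d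
    (v := ⟨σ ^ 2, sq_nonneg σ⟩) rfl).prod (measurePreserving_const_mul_pi_gaussianReal d
    (v := ⟨σ ^ 2, sq_nonneg σ⟩) rfl)
  rw [← hmp.map_eq, integral_map hmp.measurable.aemeasurable
    (Measurable.aestronglyMeasurable (by fun_prop))]
  obtain ⟨a, ha, hca⟩ : ∃ a, 0 < a ∧ c = σ ^ 2 * a :=
    ⟨c / σ ^ 2, by positivity, by field_simp⟩
  have haσ : c / σ ^ 2 = a := by rw [hca]; field_simp
  rw [haσ]
  set g : ℝ → ℝ := fun r => ((a + max r 0) ^ p)⁻¹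
  have hg : Measurable g := by fun_prop
  have hgS (z : Fin d → ℝ) : g (∑ i, z i ^ 2) = ((a + ∑ i, z i ^ 2) ^ p)⁻¹ := by
    simp only [g]
    rw [max_eq_left (by positivity)]
  have hB (r : ℝ) : |g r| ≤ (a ^ p)⁻¹ := by
    have : 0 ≤ max r 0 := le_max_right _ _
    rw [abs_of_nonneg (by positivity)]
    simp only [g]
    gcongr
    linarith
  have hint := integrable_dot_pow_mul_mul (d := d) g hg hB
  have hexp (w : (Fin d → ℝ) × (Fin d → ℝ)) :
      ((c + ∑ i, (σ * w.1 i) * (σ * w.2 i)) ^ 2 /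
        ((c + ∑ i, (σ * w.1 i) ^ 2) * (c + ∑ i, (σ * w.2 i) ^ 2))) ^ p =
      ∑ j ∈ range (2 * p + 1), ((2 * p).choose j * a ^ (2 * p - j)) *
        ((∑ i, w.1 i * w.2 i) ^ j * (g (∑ i, w.1 i ^ 2) * g (∑ i, w.2 i ^ 2))) := by
    have h1 : ∑ i, (σ * w.1 i) * (σ * w.2 i) = σ ^ 2 * ∑ i, w.1 i * w.2 i := by
      rw [mul_sum]
      exact sum_congr rfl fun i _ => by ring
    have h2 : ((a + ∑ i, w.1 i * w.2 i) ^ 2) ^ p = ∑ j ∈ range (2 * p + 1),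
        (∑ i, w.1 i * w.2 i) ^ j * a ^ (2 * p - j) * (2 * p).choose j := by
      rw [← pow_mul, add_comm, add_pow]
    simp only [h1, mul_pow, ← mul_sum, hca, ← mul_add, hgS]
    rw [show ∀ u v t : ℝ, (σ ^ 2) ^ 2 * t / (σ ^ 2 * u * (σ ^ 2 * v)) = t / (u * v) from
      fun u v t => by rw [show σ ^ 2 * u * (σ ^ 2 * v) = (σ ^ 2) ^ 2 * (u * v) by ring,
        mul_div_mul_left _ _ (by positivity)], div_pow, h2, mul_pow, div_eq_mul_inv, mul_inv,
      sum_mul]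
    exact sum_congr rfl fun j _ => by ring
  simp only [Prod.map_fst, Prod.map_snd, hexp]
  rw [integral_finsetSum _ fun j _ => (hint j).const_mul _]
  simp only [integral_const_mul]
  rw [sum_range_two_mul_add_one, sum_eq_zero (s := range p) fun k _ => by
    rw [integral_dot_odd_pow_mul_mul g k (hint _), mul_zero], add_zero]
  refine sum_congr rfl fun k _ => ?_
  rw [integral_dot_pow_mul_mul (by omega) g hg hB k (hint _)]
  simp only [hgS, div_eq_mul_inv, mul_assoc]
end

section
/- As σ → ∞, E[((c + xᵀx')²/((c+‖x‖²)(c+‖x'‖²)))^p] → Π_{i=0}^{p−1}(1+2i)/(d+2i), where x, x' ~ N(0, σ²I_d) are independent, c > 0 fixed. Hence the Gradient Alignment Complexity of the polynomial kernel converges to 1 − Π_{i=0}^{p−1}(1+2i)/(d+2i) as σ → ∞. -/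
open MeasureTheory ProbabilityTheory Finset Filter

open scoped RealInnerProductSpace

section Homogeneous

variable {E : Type*} [NormedAddCommGroup E] [InnerProductSpace ℝ E] [FiniteDimensional ℝ E]
  [MeasurableSpace E] [BorelSpace E]

lemma integrable_exp_neg_half_norm_sq :
    Integrable (fun x : E => Real.exp (-(1 / 2) * ‖x‖ ^ 2)) := by
  have h := (GaussianFourier.integrable_cexp_neg_mul_sq_norm_add (V := E) (b := ((1 / 2 : ℝ) : ℂ))
    (by norm_num) 0 0).norm
  refine h.congr (Eventually.of_forall fun x => ?_)
  beta_reduce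
  rw [Complex.norm_exp]
  congr 1
  simp [← Complex.ofReal_pow]

lemma stdGaussian_eq_withDensity :
    stdGaussian E = (volume : Measure E).withDensity (fun x => ENNReal.ofReal
      ((2 * Real.pi) ^ (-(Module.finrank ℝ E : ℝ) / 2) * Real.exp (-(1 / 2) * ‖x‖ ^ 2))) := by
  have hint : Integrable (fun x : E => (2 * Real.pi) ^ (-(Module.finrank ℝ E : ℝ) / 2) *
      Real.exp (-(1 / 2) * ‖x‖ ^ 2)) := integrable_exp_neg_half_norm_sq.const_mul _
  have : IsFiniteMeasure ((volume : Measure E).withDensity (fun x => ENNReal.ofReal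
      ((2 * Real.pi) ^ (-(Module.finrank ℝ E : ℝ) / 2) * Real.exp (-(1 / 2) * ‖x‖ ^ 2)))) :=
    isFiniteMeasure_withDensity_ofReal hint.2
  apply Measure.ext_of_charFun
  ext t
  rw [charFun_stdGaussian, charFun_apply,
    integral_withDensity_eq_integral_toReal_smul (by fun_prop)
      (Eventually.of_forall fun _ => ENNReal.ofReal_lt_top)]
  have h := GaussianFourier.integral_cexp_neg_mul_sq_norm_add (V := E) (b := ((1 / 2 : ℝ) : ℂ))
    (by norm_num) Complex.I t
  have hpi : (0 : ℝ) < 2 * Real.pi := by positivity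
  have hc : ((Real.pi : ℂ) / ((1 / 2 : ℝ) : ℂ)) ^ (Module.finrank ℝ E / 2 : ℂ) =
      (((2 * Real.pi) ^ ((Module.finrank ℝ E : ℝ) / 2) : ℝ) : ℂ) := by
    rw [Complex.ofReal_cpow hpi.le]
    push_cast
    congr 1
    ring
  calc Complex.exp (-(‖t‖ : ℂ) ^ 2 / 2)
      = (((2 * Real.pi) ^ (-(Module.finrank ℝ E : ℝ) / 2) : ℝ) : ℂ) *
        ∫ v : E, Complex.exp (-((1 / 2 : ℝ) : ℂ) * ‖v‖ ^ 2 + Complex.I * ⟪t, v⟫) := by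
        rw [h, hc, ← mul_assoc, ← Complex.ofReal_mul, ← Real.rpow_add hpi]
        rw [show -(Module.finrank ℝ E : ℝ) / 2 + (Module.finrank ℝ E : ℝ) / 2 = 0 by ring,
          Real.rpow_zero, Complex.ofReal_one, one_mul]
        congr 1
        simp [Complex.I_sq]
        ring
    _ = _ := by
        rw [← integral_const_mul]
        congr 1 with v
        rw [ENNReal.toReal_ofReal (by positivity), Complex.real_smul, Complex.ofReal_mul,
          mul_assoc, Complex.ofReal_exp, ← Complex.exp_add]
        congr 2
        rw [real_inner_comm]
        push_cast
        ring

lemma integral_stdGaussian (f : E → ℝ) :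
    ∫ x, f x ∂stdGaussian E = (2 * Real.pi) ^ (-(Module.finrank ℝ E : ℝ) / 2) *
      ∫ x, f x * Real.exp (-(1 / 2) * ‖x‖ ^ 2) := by
  rw [stdGaussian_eq_withDensity, integral_withDensity_eq_integral_toReal_smul (by fun_prop)
      (Eventually.of_forall fun _ => ENNReal.ofReal_lt_top), ← integral_const_mul]
  congr 1 with x
  rw [ENNReal.toReal_ofReal (by positivity), smul_eq_mul]
  ring

open Measure Set Metric in
lemma integral_homogeneous_mul_fun_norm [Nontrivial E] {g : E → ℝ}
    (hg : ∀ (r : ℝ) (x : E), 0 < r → g (r • x) = g x) (φ : ℝ → ℝ) :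
    ∫ x, g x * φ ‖x‖ = (∫ s : sphere (0 : E) 1, g s ∂(volume : Measure E).toSphere) *
      ∫ r in Ioi (0 : ℝ), r ^ (Module.finrank ℝ E - 1) * φ r :=
  calc
    ∫ x, g x * φ ‖x‖ = ∫ x : ({(0)}ᶜ : Set E), g x.1 * φ ‖x.1‖ ∂((volume : Measure E).comap (Subtype.val)) := by
      rw [integral_subtype_comap (measurableSet_singleton _).compl fun x ↦ g x * φ ‖x‖,
        restrict_compl_singleton]
    _ = ∫ x : sphere (0 : E) 1 × Ioi (0 : ℝ), g x.1 * φ x.2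
          ∂(volume : Measure E).toSphere.prod (.volumeIoiPow (Module.finrank ℝ E - 1)) := by
      rw [← (volume : Measure E).measurePreserving_homeomorphUnitSphereProd.integral_comp
        (Homeomorph.measurableEmbedding _)]
      congr 1 with x
      have hx : 0 < ‖(x : E)‖⁻¹ := inv_pos.2 (norm_pos_iff.2 x.2)
      simp [hg _ _ hx]
    _ = _ := by
      rw [integral_prod_mul (fun s : sphere (0 : E) 1 => g s) (fun r : Ioi (0 : ℝ) => φ r)]
      congr 1
      simp only [Measure.volumeIoiPow, ENNReal.ofReal]
      rw [integral_withDensity_eq_integral_smul,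
        integral_subtype_comap measurableSet_Ioi
          fun a ↦ Real.toNNReal (a ^ (Module.finrank ℝ E - 1)) • φ a,
        setIntegral_congr_fun measurableSet_Ioi fun x hx ↦ ?_]
      · rw [NNReal.smul_def, Real.coe_toNNReal _ (pow_nonneg hx.out.le _), smul_eq_mul]
      · exact (measurable_subtype_coe.pow_const _).real_toNNReal

lemma integral_pow_mul_exp_neg_half_sq_add_two (m : ℕ) :
    ∫ r in Set.Ioi (0 : ℝ), r ^ (m + 2) * Real.exp (-(1 / 2) * r ^ 2) =
      (m + 1) * ∫ r in Set.Ioi (0 : ℝ), r ^ m * Real.exp (-(1 / 2) * r ^ 2) := by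
  have key (k : ℕ) : ∫ r in Set.Ioi (0 : ℝ), r ^ k * Real.exp (-(1 / 2) * r ^ 2) =
      (1 / 2 : ℝ) ^ (-((k : ℝ) + 1) / 2) * (1 / 2) * Real.Gamma (((k : ℝ) + 1) / 2) := by
    rw [← integral_rpow_mul_exp_neg_mul_rpow two_pos
      (by linarith [(Nat.cast_nonneg k : (0 : ℝ) ≤ k)]) (by norm_num)]
    simp
  rw [key, key]
  push_cast
  rw [show ((m : ℝ) + 2 + 1) / 2 = ((m : ℝ) + 1) / 2 + 1 by ring,
    Real.Gamma_add_one (by positivity),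
    show -((m : ℝ) + 2 + 1) / 2 = -((m : ℝ) + 1) / 2 - 1 by ring,
    Real.rpow_sub_one (by norm_num)]
  ring

lemma integral_homogeneous_mul_norm_pow_stdGaussian [Nontrivial E] {g : E → ℝ}
    (hg : ∀ (r : ℝ) (x : E), 0 < r → g (r • x) = g x) (p : ℕ) :
    ∫ x, g x * ‖x‖ ^ (2 * p) ∂stdGaussian E =
      (∫ x, g x ∂stdGaussian E) * ∏ i ∈ range p, ((Module.finrank ℝ E : ℝ) + 2 * i) := by
  induction p with
  | zero => simp
  | succ p ih =>
    rw [prod_range_succ, ← mul_assoc, ← ih, integral_stdGaussian, integral_stdGaussian]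
    simp_rw [mul_assoc (g _)]
    rw [integral_homogeneous_mul_fun_norm hg (fun r => r ^ (2 * (p + 1)) * Real.exp (-(1 / 2) * r ^ 2)),
      integral_homogeneous_mul_fun_norm hg (fun r => r ^ (2 * p) * Real.exp (-(1 / 2) * r ^ 2))]
    simp_rw [← mul_assoc, ← pow_add]
    have hn : 0 < Module.finrank ℝ E := Module.finrank_pos
    rw [show Module.finrank ℝ E - 1 + 2 * (p + 1) = (Module.finrank ℝ E - 1 + 2 * p) + 2 by ring,
      integral_pow_mul_exp_neg_half_sq_add_two]
    push_cast [Nat.cast_sub hn]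
    ring

lemma integral_pow_gaussianReal (p : ℕ) :
    ∫ t, t ^ (2 * p) ∂gaussianReal 0 1 = ∏ i ∈ range p, (1 + 2 * (i : ℝ)) := by
  have h : stdGaussian ℝ = gaussianReal 0 1 := by
    apply Measure.ext_of_charFun
    ext t
    rw [charFun_stdGaussian, charFun_gaussianReal]
    simp [← Complex.ofReal_pow, neg_div]
  have := integral_homogeneous_mul_norm_pow_stdGaussian (E := ℝ) (g := fun _ => 1)
    (fun _ _ _ => rfl) p
  simpa [h, pow_mul] using this

lemma map_inner_stdGaussian {u : E} (hu : ‖u‖ = 1) :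
    (stdGaussian E).map (fun x => ⟪u, x⟫) = gaussianReal 0 1 := by
  have h := IsGaussian.map_eq_gaussianReal (μ := stdGaussian E) (innerSL ℝ u)
  rw [integral_strongDual_stdGaussian, variance_dual_stdGaussian] at h
  simpa [hu] using h

/-- The even moments of the cosine of the angle between a standard Gaussian vector and a fixed
direction. -/
lemma integral_cos_pow_stdGaussian [Nontrivial E] {u : E} (hu : u ≠ 0) (p : ℕ) :
    ∫ x, (⟪u, x⟫ ^ 2 / (‖u‖ ^ 2 * ‖x‖ ^ 2)) ^ p ∂stdGaussian E =
      ∏ i ∈ range p, (1 + 2 * (i : ℝ)) / ((Module.finrank ℝ E : ℝ) + 2 * i) := by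
  wlog h1 : ‖u‖ = 1 generalizing u
  · have hu' : ‖u‖ ≠ 0 := norm_ne_zero_iff.2 hu
    rw [← this (u := ‖u‖⁻¹ • u) (by simp [hu]) (by simp [norm_smul, hu])]
    congr 1 with x
    rw [real_inner_smul_left, norm_smul, norm_inv, norm_norm, inv_mul_cancel₀ hu']
    congr 1
    field_simp
  have hn : 0 < Module.finrank ℝ E := Module.finrank_pos
  rw [prod_div_distrib, eq_div_iff (prod_ne_zero_iff.2 fun i _ => by positivity),
    ← integral_homogeneous_mul_norm_pow_stdGaussian, ← integral_pow_gaussianReal,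
    ← map_inner_stdGaussian h1, integral_map (by fun_prop) (by fun_prop)]
  · congr 1 with x
    rcases eq_or_ne x 0 with rfl | hx
    · rcases p.eq_zero_or_pos with rfl | hp
      · simp
      · simp [hp.ne']
    · have : ‖x‖ ≠ 0 := norm_ne_zero_iff.2 hx
      rw [h1, pow_mul, pow_mul, ← mul_pow]
      congr 1
      field_simp
  · intro r x hr
    rw [real_inner_smul_right, norm_smul, Real.norm_of_nonneg hr.le]
    congr 1
    rw [mul_pow, mul_pow, mul_left_comm, mul_div_mul_left _ _ (by positivity)]

end Homogeneous

lemma integral_cos_pow_pi_gaussianReal {d : ℕ} [NeZero d] {y : Fin d → ℝ} (hy : y ≠ 0) (p : ℕ) :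
    ∫ x, ((∑ i, y i * x i) ^ 2 / ((∑ i, y i ^ 2) * ∑ i, x i ^ 2)) ^ p
        ∂(Measure.pi fun _ : Fin d => gaussianReal 0 1) =
      ∏ i ∈ range p, (1 + 2 * (i : ℝ)) / ((d : ℝ) + 2 * i) := by
  have h := integral_cos_pow_stdGaussian (E := EuclideanSpace ℝ (Fin d)) (u := WithLp.toLp 2 y)
    (by simpa using hy) p
  rw [← map_pi_eq_stdGaussian, integral_map (by fun_prop)
    (Measurable.aestronglyMeasurable (by fun_prop)), finrank_euclideanSpace_fin] at h
  rw [← h]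
  congr 1 with x
  simp [EuclideanSpace.real_norm_sq_eq, PiLp.inner_apply, mul_comm]

lemma pi_gaussianReal_sq (d : ℕ) (σ : ℝ) :
    (Measure.pi fun _ : Fin d => gaussianReal 0 ⟨σ ^ 2, sq_nonneg σ⟩) =
      (Measure.pi fun _ : Fin d => gaussianReal 0 1).map (fun x i => σ * x i) := by
  have h := gaussianReal_map_const_mul (μ := 0) (v := 1) σ
  rw [mul_zero, mul_one] at h
  have : IsProbabilityMeasure ((gaussianReal 0 1).map (σ * ·)) := by
    rw [h]; infer_instance
  rw [Measure.pi_map_pi (f := fun _ t => σ * t) fun _ => by fun_prop]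
  simp_rw [h]
  rfl

lemma sq_add_sum_mul_le {ι : Type*} [Fintype ι] {c : ℝ} (hc : 0 ≤ c) (x y : ι → ℝ) :
    (c + ∑ i, x i * y i) ^ 2 ≤ (c + ∑ i, x i ^ 2) * (c + ∑ i, y i ^ 2) := by
  have h := sum_mul_sq_le_sq_mul_sq univ
    (fun o : Option ι => o.elim √c x) (fun o : Option ι => o.elim √c y)
  simpa [Fintype.sum_option, Real.mul_self_sqrt hc, Real.sq_sqrt hc] using h

lemma tendsto_normalized_kernel {a b : ℝ} (ha : 0 < a) (hb : 0 < b) (c s : ℝ) :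
    Tendsto (fun σ : ℝ => (c + σ ^ 2 * s) ^ 2 / ((c + σ ^ 2 * a) * (c + σ ^ 2 * b))) atTop
      (nhds (s ^ 2 / (a * b))) := by
  have h0 : Tendsto (fun σ : ℝ => c * (σ ^ 2)⁻¹) atTop (nhds 0) := by
    simpa using (tendsto_pow_atTop (α := ℝ) two_ne_zero).inv_tendsto_atTop.const_mul c
  have h (t : ℝ) : Tendsto (fun σ : ℝ => c * (σ ^ 2)⁻¹ + t) atTop (nhds t) := by
    simpa using h0.add_const t
  refine (((h s).pow 2).div ((h a).mul (h b)) (by positivity)).congr' ?_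
  filter_upwards [eventually_gt_atTop 0] with σ hσ
  have e (t : ℝ) : c + σ ^ 2 * t = σ ^ 2 * (c * (σ ^ 2)⁻¹ + t) := by field_simp
  have h2 : (σ ^ 2) ^ 2 ≠ 0 := by positivity
  rw [e s, e a, e b, mul_mul_mul_comm, mul_pow, ← sq (σ ^ 2), mul_div_mul_left _ _ h2]
  rfl

/-- As σ → ∞, the expected squared normalized polynomial kernel for
independent x, x' ~ N(0, σ²I_d) converges to ∏_{i=0}^{p−1}(1+2i)/(d+2i);
hence the polynomial-kernel GAC converges to 1 − ∏_{i=0}^{p−1}(1+2i)/(d+2i). -/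
theorem polynomial_gac_limit_sigma_infty
    (d : ℕ) (hd : 2 ≤ d) (c : ℝ) (hc : 0 < c) (p : ℕ) :
    Tendsto (fun σ : ℝ =>
        ∫ xx : (Fin d → ℝ) × (Fin d → ℝ),
          ((c + ∑ i, xx.1 i * xx.2 i) ^ 2 /
            ((c + ∑ i, (xx.1 i) ^ 2) * (c + ∑ i, (xx.2 i) ^ 2))) ^ p
        ∂((Measure.pi fun _ : Fin d => gaussianReal 0 ⟨σ ^ 2, sq_nonneg σ⟩).prod
            (Measure.pi fun _ : Fin d => gaussianReal 0 ⟨σ ^ 2, sq_nonneg σ⟩)))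
      atTop
      (nhds (∏ i ∈ Finset.range p, (1 + 2 * (i : ℝ)) / ((d : ℝ) + 2 * i))) ∧
    Tendsto (fun σ : ℝ =>
        1 - ∫ xx : (Fin d → ℝ) × (Fin d → ℝ),
          ((c + ∑ i, xx.1 i * xx.2 i) ^ 2 /
            ((c + ∑ i, (xx.1 i) ^ 2) * (c + ∑ i, (xx.2 i) ^ 2))) ^ p
        ∂((Measure.pi fun _ : Fin d => gaussianReal 0 ⟨σ ^ 2, sq_nonneg σ⟩).prod
            (Measure.pi fun _ : Fin d => gaussianReal 0 ⟨σ ^ 2, sq_nonneg σ⟩)))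
      atTop
      (nhds (1 - ∏ i ∈ Finset.range p, (1 + 2 * (i : ℝ)) / ((d : ℝ) + 2 * i))) := by
  have : NeZero d := ⟨by omega⟩
  have := nullSingletonClass_gaussianReal (μ := 0) (v := 1) one_ne_zero
  set γ : Measure (Fin d → ℝ) := Measure.pi fun _ : Fin d => gaussianReal 0 1 with hγ
  have hpos {x : Fin d → ℝ} (hx : x ≠ 0) : 0 < ∑ i, x i ^ 2 := by
    obtain ⟨i, hi⟩ := Function.ne_iff.1 hx
    exact sum_pos' (fun _ _ => sq_nonneg _) ⟨i, mem_univ i, sq_pos_of_ne_zero hi⟩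
  have hne : ∀ᵐ x ∂γ, x ≠ 0 := by simp [ae_iff]
  have hbound {c : ℝ} (hc : 0 ≤ c) (x y : Fin d → ℝ) :
      ‖((c + ∑ i, x i * y i) ^ 2 / ((c + ∑ i, x i ^ 2) * (c + ∑ i, y i ^ 2))) ^ p‖ ≤ 1 := by
    have hx : 0 ≤ c + ∑ i, x i ^ 2 := by positivity
    have hy : 0 ≤ c + ∑ i, y i ^ 2 := by positivity
    rw [Real.norm_of_nonneg (by positivity)]
    exact pow_le_one₀ (by positivity)
      (div_le_one_of_le₀ (sq_add_sum_mul_le hc x y) (mul_nonneg hx hy))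
  have hlim : ∫ z : (Fin d → ℝ) × (Fin d → ℝ),
      ((∑ i, z.1 i * z.2 i) ^ 2 / ((∑ i, z.1 i ^ 2) * ∑ i, z.2 i ^ 2)) ^ p ∂γ.prod γ =
      ∏ i ∈ range p, (1 + 2 * (i : ℝ)) / ((d : ℝ) + 2 * i) := by
    rw [integral_prod]
    · rw [integral_congr_ae (g := fun _ => ∏ i ∈ range p, (1 + 2 * (i : ℝ)) / ((d : ℝ) + 2 * i))]
      · simp
      · filter_upwards [hne] with x hx using integral_cos_pow_pi_gaussianReal hx p
    · refine Integrable.of_bound (Measurable.aestronglyMeasurable (by fun_prop)) 1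
        (Eventually.of_forall fun z => ?_)
      simpa using hbound le_rfl z.1 z.2
  have hscale (σ : ℝ) : ∫ xx : (Fin d → ℝ) × (Fin d → ℝ),
          ((c + ∑ i, xx.1 i * xx.2 i) ^ 2 /
            ((c + ∑ i, (xx.1 i) ^ 2) * (c + ∑ i, (xx.2 i) ^ 2))) ^ p
        ∂((Measure.pi fun _ : Fin d => gaussianReal 0 ⟨σ ^ 2, sq_nonneg σ⟩).prod
            (Measure.pi fun _ : Fin d => gaussianReal 0 ⟨σ ^ 2, sq_nonneg σ⟩)) =
      ∫ z : (Fin d → ℝ) × (Fin d → ℝ), ((c + σ ^ 2 * ∑ i, z.1 i * z.2 i) ^ 2 /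
        ((c + σ ^ 2 * ∑ i, z.1 i ^ 2) * (c + σ ^ 2 * ∑ i, z.2 i ^ 2))) ^ p ∂γ.prod γ := by
    rw [pi_gaussianReal_sq, Measure.map_prod_map _ _ (by fun_prop) (by fun_prop),
      integral_map (by fun_prop) (Measurable.aestronglyMeasurable (by fun_prop))]
    simp only [Prod.map_fst, Prod.map_snd, mul_pow, mul_mul_mul_comm σ, ← sq, ← mul_sum, hγ]
  have main : Tendsto (fun σ : ℝ =>
        ∫ xx : (Fin d → ℝ) × (Fin d → ℝ),
          ((c + ∑ i, xx.1 i * xx.2 i) ^ 2 /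
            ((c + ∑ i, (xx.1 i) ^ 2) * (c + ∑ i, (xx.2 i) ^ 2))) ^ p
        ∂((Measure.pi fun _ : Fin d => gaussianReal 0 ⟨σ ^ 2, sq_nonneg σ⟩).prod
            (Measure.pi fun _ : Fin d => gaussianReal 0 ⟨σ ^ 2, sq_nonneg σ⟩)))
      atTop
      (nhds (∏ i ∈ Finset.range p, (1 + 2 * (i : ℝ)) / ((d : ℝ) + 2 * i))) := by
    simp_rw [hscale, ← hlim]
    refine tendsto_integral_filter_of_dominated_convergence (fun _ => 1)
      (Eventually.of_forall fun σ => Measurable.aestronglyMeasurable (by fun_prop))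
      (Eventually.of_forall fun σ => Eventually.of_forall fun z => ?_)
      (integrable_const _) ?_
    · have h := hbound hc.le (fun i => σ * z.1 i) (fun i => σ * z.2 i)
      simp only [mul_pow, mul_mul_mul_comm σ, ← sq, ← mul_sum] at h
      exact h
    · filter_upwards [Measure.quasiMeasurePreserving_fst.ae hne,
        Measure.quasiMeasurePreserving_snd.ae hne] with z h1 h2
      exact (tendsto_normalized_kernel (hpos h1) (hpos h2) c _).pow p
  exact ⟨main, main.const_sub 1⟩
end
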